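/- Let γ > 0, σ > 0, μ ∈ ℝ, l < u, and set s := √(γ² + σ²), a := (l−μ)/s, b := (u−μ)/s. Then Φ(b) − Φ(a) > 0, the integrals below are finite, and ∫_ℝ x · N(x; μ, γ²) · ( Φ((u−x)/σ) − Φ((l−x)/σ) ) dx / ∫_ℝ N(x; μ, γ²) · ( Φ((u−x)/σ) − Φ((l−x)/σ) ) dx = μ + (γ²/s) · ( φ(a) − φ(b) ) / ( Φ(b) − Φ(a) ). (Theorem 3, scalar form: closed-form posterior mean under a quantized Gaussian observation.) -/

import Mathlib

open MeasureTheory Real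

/-- Gaussian density `N(x; m, v)` with mean `m` and variance `v`. -/
noncomputable def gaussN (x m v : ℝ) : ℝ :=
  (Real.sqrt (2 * Real.pi * v))⁻¹ * Real.exp (-(x - m) ^ 2 / (2 * v))

/-- Standard normal density. -/
noncomputable def stdGaussPDF (z : ℝ) : ℝ :=
  (Real.sqrt (2 * Real.pi))⁻¹ * Real.exp (-z ^ 2 / 2)

/-- Standard normal CDF. -/
noncomputable def stdGaussCDF (z : ℝ) : ℝ :=
  ∫ t in Set.Iic z, stdGaussPDF t

open ProbabilityTheory

lemma stdGaussPDF_eq_gaussianPDFReal : stdGaussPDF = gaussianPDFReal 0 1 := by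
  ext x
  simp [stdGaussPDF, gaussianPDFReal]

lemma gaussN_eq_gaussianPDFReal (x m τ : ℝ) :
    gaussN x m (τ ^ 2) = gaussianPDFReal m (.mk (τ ^ 2) (sq_nonneg τ)) x := rfl

lemma nnreal_mk_sq_ne_zero {τ : ℝ} (hτ : 0 < τ) : NNReal.mk (τ ^ 2) (sq_nonneg τ) ≠ 0 := by
  rw [← NNReal.coe_ne_zero]
  exact (pow_pos hτ 2).ne'

lemma gaussN_sq_eq {τ : ℝ} (hτ : 0 < τ) (x m : ℝ) :
    gaussN x m (τ ^ 2) = stdGaussPDF ((x - m) / τ) / τ := by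
  have hexp : -(x - m) ^ 2 / (2 * τ ^ 2) = -((x - m) / τ) ^ 2 / 2 := by field_simp
  rw [gaussN, stdGaussPDF, Real.sqrt_mul (by positivity), Real.sqrt_sq hτ.le, mul_inv, hexp]
  ring

lemma integrable_stdGaussPDF : Integrable stdGaussPDF := by
  rw [stdGaussPDF_eq_gaussianPDFReal]
  exact integrable_gaussianPDFReal 0 1

lemma stdGaussCDF_eq_measureReal (z : ℝ) :
    stdGaussCDF z = (gaussianReal 0 1).real (Set.Iic z) := by
  rw [stdGaussCDF, stdGaussPDF_eq_gaussianPDFReal, measureReal_def,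
    gaussianReal_apply_eq_integral 0 one_ne_zero, ENNReal.toReal_ofReal]
  exact integral_nonneg fun x => gaussianPDFReal_nonneg 0 1 x

lemma stdGaussCDF_nonneg (z : ℝ) : 0 ≤ stdGaussCDF z := by
  rw [stdGaussCDF_eq_measureReal]
  exact measureReal_nonneg

lemma stdGaussCDF_le_one (z : ℝ) : stdGaussCDF z ≤ 1 := by
  rw [stdGaussCDF_eq_measureReal]
  exact measureReal_le_one

lemma stdGaussCDF_sub (a b : ℝ) :
    stdGaussCDF b - stdGaussCDF a = ∫ t in a..b, stdGaussPDF t :=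
  intervalIntegral.integral_Iic_sub_Iic integrable_stdGaussPDF.integrableOn
    integrable_stdGaussPDF.integrableOn

lemma continuous_stdGaussPDF : Continuous stdGaussPDF := by
  unfold stdGaussPDF
  fun_prop

lemma stdGaussPDF_pos (z : ℝ) : 0 < stdGaussPDF z := by
  unfold stdGaussPDF
  positivity

lemma strictMono_stdGaussCDF : StrictMono stdGaussCDF := by
  intro a b hab
  rw [← sub_pos, stdGaussCDF_sub]
  exact intervalIntegral.intervalIntegral_pos_of_pos
    (continuous_stdGaussPDF.intervalIntegrable a b) stdGaussPDF_pos hab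

lemma hasDerivAt_stdGaussCDF (z : ℝ) : HasDerivAt stdGaussCDF (stdGaussPDF z) z := by
  have h : stdGaussCDF = fun w => stdGaussCDF 0 + ∫ t in (0 : ℝ)..w, stdGaussPDF t := by
    ext w
    rw [← stdGaussCDF_sub]
    ring
  rw [h]
  exact (continuous_stdGaussPDF.integral_hasStrictDerivAt 0 z).hasDerivAt.const_add _

lemma measureReal_gaussianReal_Iic {τ : ℝ} (hτ : 0 < τ) (m c : ℝ) :
    (gaussianReal m (.mk (τ ^ 2) (sq_nonneg τ))).real (Set.Iic c)
      = stdGaussCDF ((c - m) / τ) := by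
  have hmap : gaussianReal m (.mk (τ ^ 2) (sq_nonneg τ))
      = (gaussianReal 0 1).map (fun x => τ * x + m) := by
    have hcomp : (fun x : ℝ => τ * x + m) = (fun x => x + m) ∘ (fun x => τ * x) := rfl
    rw [hcomp, ← Measure.map_map (by fun_prop) (by fun_prop), gaussianReal_map_const_mul,
      gaussianReal_map_add_const]
    simp
  rw [hmap, map_measureReal_apply (by fun_prop) measurableSet_Iic, stdGaussCDF_eq_measureReal]
  congr 1
  ext x
  simp only [Set.mem_preimage, Set.mem_Iic, le_div_iff₀ hτ]
  constructor <;> intro h <;> linarith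

lemma integral_gaussN_mul_stdGaussCDF {γ σ s : ℝ} (hγ : 0 < γ) (hσ : 0 < σ) (hs : 0 < s)
    (hsq : s ^ 2 = γ ^ 2 + σ ^ 2) (μ c : ℝ) :
    ∫ x, gaussN x μ (γ ^ 2) * stdGaussCDF ((c - x) / σ) = stdGaussCDF ((c - μ) / s) := by
  have hconv := gaussianReal_conv_gaussianReal (m₁ := μ) (m₂ := 0)
    (v₁ := .mk (γ ^ 2) (sq_nonneg γ)) (v₂ := .mk (σ ^ 2) (sq_nonneg σ))
  have hvar : (NNReal.mk (γ ^ 2) (sq_nonneg γ) + NNReal.mk (σ ^ 2) (sq_nonneg σ))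
      = NNReal.mk (s ^ 2) (sq_nonneg s) := NNReal.eq hsq.symm
  rw [add_zero, hvar] at hconv
  rw [← measureReal_gaussianReal_Iic hs, ← integral_indicator_one measurableSet_Iic, ← hconv,
    integral_conv ((integrable_const 1).indicator measurableSet_Iic),
    integral_gaussianReal_eq_integral_smul (nnreal_mk_sq_ne_zero hγ)]
  refine integral_congr_ae (ae_of_all _ fun x => ?_)
  have hind : (fun y => (Set.Iic c).indicator (1 : ℝ → ℝ) (x + y))
      = (Set.Iic (c - x)).indicator 1 := by
    ext y
    simp [Set.indicator_apply, le_sub_iff_add_le']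
  simp only [smul_eq_mul, hind]
  rw [integral_indicator_one measurableSet_Iic, measureReal_gaussianReal_Iic hσ, sub_zero,
    gaussN_eq_gaussianPDFReal]

lemma gaussN_mul_stdGaussPDF {γ σ s : ℝ} (hγ : 0 < γ) (hσ : 0 < σ) (hs : 0 < s)
    (hsq : s ^ 2 = γ ^ 2 + σ ^ 2) (μ c x : ℝ) :
    gaussN x μ (γ ^ 2) * (stdGaussPDF ((c - x) / σ) / σ)
      = stdGaussPDF ((c - μ) / s) / s
        * gaussN x ((σ ^ 2 * μ + γ ^ 2 * c) / s ^ 2) ((γ * σ / s) ^ 2) := by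
  rw [gaussN_sq_eq hγ, gaussN_sq_eq (by positivity)]
  have hexp : -((x - μ) / γ) ^ 2 / 2 + -((c - x) / σ) ^ 2 / 2
      = -((c - μ) / s) ^ 2 / 2
        + -((x - (σ ^ 2 * μ + γ ^ 2 * c) / s ^ 2) / (γ * σ / s)) ^ 2 / 2 := by
    have hσ' : σ ^ 2 = s ^ 2 - γ ^ 2 := by linarith
    field_simp
    rw [hσ']
    ring
  have hmul := congrArg Real.exp hexp
  rw [Real.exp_add, Real.exp_add] at hmul
  simp only [stdGaussPDF]
  generalize Real.exp _ = e₁ at *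
  generalize Real.exp _ = e₂ at *
  generalize Real.exp _ = e₃ at *
  generalize Real.exp _ = e₄ at *
  field_simp
  linear_combination hmul

lemma integrable_gaussN (m τ : ℝ) : Integrable (fun x => gaussN x m (τ ^ 2)) :=
  integrable_gaussianPDFReal m (.mk (τ ^ 2) (sq_nonneg τ))

lemma integral_gaussN {τ : ℝ} (hτ : 0 < τ) (m : ℝ) : ∫ x, gaussN x m (τ ^ 2) = 1 :=
  integral_gaussianPDFReal_eq_one m (nnreal_mk_sq_ne_zero hτ)

lemma integrable_id_mul_gaussN {τ : ℝ} (hτ : 0 < τ) (m : ℝ) :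
    Integrable (fun x => x * gaussN x m (τ ^ 2)) := by
  have h : Integrable (fun x : ℝ => x) (gaussianReal m (.mk (τ ^ 2) (sq_nonneg τ))) :=
    memLp_one_iff_integrable.mp (memLp_id_gaussianReal 1)
  rw [gaussianReal_of_var_ne_zero _ (nnreal_mk_sq_ne_zero hτ),
    integrable_withDensity_iff_integrable_smul' (measurable_gaussianPDF _ _)
      (ae_of_all _ fun _ => gaussianPDF_lt_top)] at h
  refine h.congr (ae_of_all _ fun x => ?_)
  simp only [toReal_gaussianPDF, smul_eq_mul, gaussN_eq_gaussianPDFReal]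
  ring

lemma MeasureTheory.Integrable.mul_stdGaussCDF {f : ℝ → ℝ} (hf : Integrable f) (c σ : ℝ) :
    Integrable (fun x => f x * stdGaussCDF ((c - x) / σ)) := by
  have hcont : Continuous stdGaussCDF :=
    continuous_iff_continuousAt.2 fun z => (hasDerivAt_stdGaussCDF z).continuousAt
  refine hf.mul_bdd (c := 1) (by fun_prop) (ae_of_all _ fun x => ?_)
  rw [Real.norm_of_nonneg (stdGaussCDF_nonneg _)]
  exact stdGaussCDF_le_one _

lemma hasDerivAt_gaussN {v : ℝ} (hv : v ≠ 0) (m x : ℝ) :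
    HasDerivAt (fun x => gaussN x m v) (-((x - m) * gaussN x m v) / v) x := by
  have h := ((((hasDerivAt_id x).sub_const m).pow 2).neg.div_const (2 * v)).exp.const_mul
    (Real.sqrt (2 * Real.pi * v))⁻¹
  convert! h using 1
  simp [gaussN]
  field_simp

lemma hasDerivAt_stdGaussCDF_sub_div (c σ x : ℝ) :
    HasDerivAt (fun x => stdGaussCDF ((c - x) / σ)) (-(stdGaussPDF ((c - x) / σ) / σ)) x := by
  have h := (hasDerivAt_stdGaussCDF ((c - x) / σ)).comp x
    (((hasDerivAt_id x).const_sub c).div_const σ)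
  convert! h using 1
  ring

lemma integrable_sub_mul_gaussN {τ : ℝ} (hτ : 0 < τ) (m : ℝ) :
    Integrable (fun x => (x - m) * gaussN x m (τ ^ 2)) := by
  simp only [sub_mul]
  exact (integrable_id_mul_gaussN hτ m).sub ((integrable_gaussN m τ).const_mul m)

lemma integral_sub_mul_gaussN_mul_stdGaussCDF {γ σ s : ℝ} (hγ : 0 < γ) (hσ : 0 < σ)
    (hs : 0 < s) (hsq : s ^ 2 = γ ^ 2 + σ ^ 2) (μ c : ℝ) :
    ∫ x, (x - μ) * gaussN x μ (γ ^ 2) * stdGaussCDF ((c - x) / σ)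
      = -(γ ^ 2 / s * stdGaussPDF ((c - μ) / s)) := by
  have hγ2 : γ ^ 2 ≠ 0 := by positivity
  have hprod : ∀ x, -(stdGaussPDF ((c - x) / σ) / σ) * gaussN x μ (γ ^ 2)
      = -(stdGaussPDF ((c - μ) / s) / s)
        * gaussN x ((σ ^ 2 * μ + γ ^ 2 * c) / s ^ 2) ((γ * σ / s) ^ 2) := fun x => by
    linear_combination -gaussN_mul_stdGaussPDF hγ hσ hs hsq μ c x
  have hparts := integral_mul_deriv_eq_deriv_mul_of_integrable
    (u := fun x => stdGaussCDF ((c - x) / σ)) (v := fun x => gaussN x μ (γ ^ 2))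
    (fun x _ => hasDerivAt_stdGaussCDF_sub_div c σ x) (fun x _ => hasDerivAt_gaussN hγ2 μ x)
    ((((integrable_sub_mul_gaussN hγ μ).mul_stdGaussCDF c σ).const_mul (-(γ ^ 2)⁻¹)).congr
      (ae_of_all _ fun x => by simp only [Pi.mul_apply]; ring))
    (((integrable_gaussN _ _).const_mul _).congr (ae_of_all _ fun x => (hprod x).symm))
    (((integrable_gaussN μ γ).mul_stdGaussCDF c σ).congr (ae_of_all _ fun x => mul_comm _ _))
  simp only [hprod] at hparts
  rw [integral_const_mul, integral_gaussN (by positivity)] at hparts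
  calc _ = ∫ x, -γ ^ 2
          * (stdGaussCDF ((c - x) / σ) * (-((x - μ) * gaussN x μ (γ ^ 2)) / γ ^ 2)) := by
        congr with x
        field_simp
    _ = _ := by
        rw [integral_const_mul, hparts]
        ring

/-- Theorem 3, scalar form: closed-form posterior mean under a quantized Gaussian
observation. -/
theorem stmt_12 (γ σ μ l u : ℝ) (hγ : 0 < γ) (hσ : 0 < σ) (hlu : l < u)
    (s a b : ℝ) (hs : s = Real.sqrt (γ ^ 2 + σ ^ 2))
    (ha : a = (l - μ) / s) (hb : b = (u - μ) / s) :
    0 < stdGaussCDF b - stdGaussCDF a ∧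
    Integrable (fun x : ℝ =>
      gaussN x μ (γ ^ 2) * (stdGaussCDF ((u - x) / σ) - stdGaussCDF ((l - x) / σ))) volume ∧
    Integrable (fun x : ℝ =>
      x * (gaussN x μ (γ ^ 2) * (stdGaussCDF ((u - x) / σ) - stdGaussCDF ((l - x) / σ)))) volume ∧
    (∫ x : ℝ, x * (gaussN x μ (γ ^ 2) * (stdGaussCDF ((u - x) / σ) - stdGaussCDF ((l - x) / σ)))) /
        (∫ x : ℝ, gaussN x μ (γ ^ 2) * (stdGaussCDF ((u - x) / σ) - stdGaussCDF ((l - x) / σ))) =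
      μ + γ ^ 2 / s * ((stdGaussPDF a - stdGaussPDF b) / (stdGaussCDF b - stdGaussCDF a)) := by
  subst ha hb
  have hs0 : 0 < s := hs ▸ Real.sqrt_pos.2 (by positivity)
  have hsq : s ^ 2 = γ ^ 2 + σ ^ 2 := by rw [hs, Real.sq_sqrt (by positivity)]
  have hpos : 0 < stdGaussCDF ((u - μ) / s) - stdGaussCDF ((l - μ) / s) :=
    sub_pos.2 (strictMono_stdGaussCDF (by gcongr))
  have hN := fun c => (integrable_gaussN μ γ).mul_stdGaussCDF c σ
  have hM := fun c => (integrable_sub_mul_gaussN hγ μ).mul_stdGaussCDF c σ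
  have hden : Integrable (fun x : ℝ => gaussN x μ (γ ^ 2)
      * (stdGaussCDF ((u - x) / σ) - stdGaussCDF ((l - x) / σ))) := by
    simp only [mul_sub]
    exact (hN u).sub (hN l)
  have hdenval : ∫ x : ℝ, gaussN x μ (γ ^ 2)
      * (stdGaussCDF ((u - x) / σ) - stdGaussCDF ((l - x) / σ))
      = stdGaussCDF ((u - μ) / s) - stdGaussCDF ((l - μ) / s) := by
    simp only [mul_sub]
    rw [integral_sub (hN u) (hN l), integral_gaussN_mul_stdGaussCDF hγ hσ hs0 hsq,
      integral_gaussN_mul_stdGaussCDF hγ hσ hs0 hsq]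
  have hsplit : (fun x : ℝ => x * (gaussN x μ (γ ^ 2)
      * (stdGaussCDF ((u - x) / σ) - stdGaussCDF ((l - x) / σ))))
      = fun x => ((x - μ) * gaussN x μ (γ ^ 2) * stdGaussCDF ((u - x) / σ)
          - (x - μ) * gaussN x μ (γ ^ 2) * stdGaussCDF ((l - x) / σ))
        + μ * (gaussN x μ (γ ^ 2)
          * (stdGaussCDF ((u - x) / σ) - stdGaussCDF ((l - x) / σ))) := by
    ext x
    ring
  have hdiff : Integrable (fun x => (x - μ) * gaussN x μ (γ ^ 2) * stdGaussCDF ((u - x) / σ)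
      - (x - μ) * gaussN x μ (γ ^ 2) * stdGaussCDF ((l - x) / σ)) := (hM u).sub (hM l)
  refine ⟨hpos, hden, ?_, ?_⟩
  · rw [hsplit]
    exact hdiff.add (hden.const_mul μ)
  · rw [hsplit, integral_add hdiff (hden.const_mul μ), integral_sub (hM u) (hM l),
      integral_const_mul, hdenval, integral_sub_mul_gaussN_mul_stdGaussCDF hγ hσ hs0 hsq,
      integral_sub_mul_gaussN_mul_stdGaussCDF hγ hσ hs0 hsq]
    field_simp
    ring
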